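/- Let A = (V, E_R, E_W) be an annotation DAG and (p, Rd, Wt) a label. Let v = (p, max_p(V)+1) and define A' = (V ∪ {v}, E_R ∪ {(last(r,E_W), r, v) | r ∈ Rd \ Wt}, E_W ∪ {(last(r,E_W), r, v) | r ∈ Wt}). Then v ∉ V and A' is again an annotation DAG (it satisfies all five defining conditions); in particular, for every annotation DAG A and every label (p, Rd, Wt) there exists an annotation DAG A' with A ⇀(p,Rd,Wt) A'. -/

import Mathlib

namespace CRIL

/-- Process identifiers: finite lists of positive integers. -/
abbrev PID := List ℕ+

/-- Nodes of an annotation DAG: either ⊥ or a pair (p, n). -/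
inductive ANode where
  | bot : ANode
  | node : PID → ℕ → ANode
deriving DecidableEq

/-- Labeled edges. -/
abbrev AEdge (R : Type) := ANode × R × ANode

/-- Annotation DAGs, with the five defining conditions. -/
structure AnnDAG (R : Type) where
  V : Set ANode
  ER : Set (AEdge R)
  EW : Set (AEdge R)
  finV : V.Finite
  bot_mem : ANode.bot ∈ V
  down : ∀ p n, ANode.node p n ∈ V → ∀ n' ≤ n, ANode.node p n' ∈ V
  edges_sub : ∀ e ∈ ER ∪ EW, e.1 ∈ V ∧ e.2.2 ∈ V
  in_unique : ∀ v' v'' r v, (v', r, v) ∈ ER ∪ EW → (v'', r, v) ∈ ER ∪ EW → v' = v''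
  disj : ER ∩ EW = ∅
  acyclic : ∀ v, ¬ Relation.TransGen (fun a b => ∃ r, (a, r, b) ∈ ER ∪ EW) v v
  w_pred : ∀ v' r v, (v', r, v) ∈ EW → v' ≠ ANode.bot → ∃ v'', (v'', r, v') ∈ EW
  w_out_unique : ∀ v r v' v'', (v, r, v') ∈ EW → (v, r, v'') ∈ EW → v' = v''

-- `last(r, E_W)`: the final node of the unique maximal chain of `r`-labeled
-- `E_W`-edges starting at ⊥ (⊥ if there is no such edge).
open Classical in
noncomputable def lastN {R : Type} (EW : Set (AEdge R)) (r : R) : ANode :=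
  if h : ∃! v, Relation.ReflTransGen (fun a b => (a, r, b) ∈ EW) ANode.bot v ∧
      ∀ w, (v, r, w) ∉ EW
  then h.exists.choose
  else ANode.bot

/-- `max_p(V) + 1`: one plus the largest `n` with `(p,n) ∈ V` (0 if none). -/
noncomputable def maxpSucc (V : Set ANode) (p : PID) : ℕ :=
  sSup {m : ℕ | ∃ n, m = n + 1 ∧ ANode.node p n ∈ V}

/-- `max_p(V)` as an integer, −1 if no `(p,n) ∈ V`. -/
noncomputable def maxp (V : Set ANode) (p : PID) : ℤ :=
  (maxpSucc V p : ℤ) - 1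

/-- Labels (p, Rd, Wt). -/
abbrev Label (R : Type) := PID × Set R × Set R

/-- Forward annotation transition A₁ ⇀(p,Rd,Wt) A₂. -/
def Step {R : Type} (A₁ A₂ : AnnDAG R) (p : PID) (Rd Wt : Set R) : Prop :=
  A₂.V = A₁.V ∪ {ANode.node p (maxpSucc A₁.V p)} ∧
  A₂.ER = A₁.ER ∪
    {e | ∃ r ∈ Rd \ Wt, e = (lastN A₁.EW r, r, ANode.node p (maxpSucc A₁.V p))} ∧
  A₂.EW = A₁.EW ∪
    {e | ∃ r ∈ Wt, e = (lastN A₁.EW r, r, ANode.node p (maxpSucc A₁.V p))}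

/-- Forward transition with some label. -/
def StepAny {R : Type} (A₁ A₂ : AnnDAG R) : Prop := ∃ p Rd Wt, Step A₁ A₂ p Rd Wt

/-- Forward transition with some label in `O`. -/
def StepIn {R : Type} (O : Set (Label R)) (A₁ A₂ : AnnDAG R) : Prop :=
  ∃ l ∈ O, Step A₁ A₂ l.1 l.2.1 l.2.2

/-- The initial annotation DAG ({⊥}, ∅, ∅). -/
def Ainit (R : Type) : AnnDAG R where
  V := {ANode.bot}
  ER := ∅
  EW := ∅
  finV := Set.finite_singleton _
  bot_mem := rfl
  down := by intro p n h; simp at h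
  edges_sub := by intro e he; simp at he
  in_unique := by intro v' v'' r v h; simp at h
  disj := by simp
  acyclic := by
    intro v h
    have hne : ∀ a b : ANode, ¬ ∃ r : R, (a, r, b) ∈ (∅ ∪ ∅ : Set (AEdge R)) := by simp
    cases h with
    | single h' => exact hne _ _ h'
    | tail _ h' => exact hne _ _ h'
  w_pred := by intro v' r v h; simp at h
  w_out_unique := by intro v r v' v'' h; simp at h

/-- Signed labels: forward or underlined (backward). -/
inductive SLabel (R : Type) where
  | fwd : Label R → SLabel R
  | bwd : Label R → SLabel R

/-- `und`: forget the underline. -/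
def und {R : Type} : SLabel R → Label R
  | .fwd a => a
  | .bwd a => a

/-- The underline-toggle. -/
def toggle {R : Type} : SLabel R → SLabel R
  | .fwd a => .bwd a
  | .bwd a => .fwd a

/-- Combined transitions: forward, or reversed forward. -/
def CStep {R : Type} (A A' : AnnDAG R) : SLabel R → Prop
  | .fwd a => Step A A' a.1 a.2.1 a.2.2
  | .bwd a => Step A' A a.1 a.2.1 a.2.2

/-- Independence of signed labels: incomparable pids and disjoint read/write sets. -/
def indepLab {R : Type} (α β : SLabel R) : Prop :=
  ¬ (und α).1 <+: (und β).1 ∧ ¬ (und β).1 <+: (und α).1 ∧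
  (und α).2.1 ∩ (und β).2.2 = ∅ ∧ (und β).2.1 ∩ (und α).2.2 = ∅

/-- `diff` of a combined transition. -/
def diff {R : Type} (A A' : AnnDAG R) (α : SLabel R) :
    Set ANode × Set (AEdge R) × Set (AEdge R) :=
  match α with
  | .fwd _ => (A'.V \ A.V, A'.ER \ A.ER, A'.EW \ A.EW)
  | .bwd _ => (A.V \ A'.V, A.ER \ A'.ER, A.EW \ A'.EW)

/-- The underlying triple of an annotation DAG. -/
def triple {R : Type} (A : AnnDAG R) : Set ANode × Set (AEdge R) × Set (AEdge R) :=
  (A.V, A.ER, A.EW)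

/-- The ⊙^α operation on triples. -/
def odot {R : Type} (α : SLabel R)
    (T Δ : Set ANode × Set (AEdge R) × Set (AEdge R)) :
    Set ANode × Set (AEdge R) × Set (AEdge R) :=
  match α with
  | .fwd _ => (T.1 ∪ Δ.1, T.2.1 ∪ Δ.2.1, T.2.2 ∪ Δ.2.2)
  | .bwd _ => (T.1 \ Δ.1, T.2.1 \ Δ.2.1, T.2.2 \ Δ.2.2)


theorem node_maxpSucc_notMem {V : Set ANode} (hV : V.Finite) (p : PID) :
    ANode.node p (maxpSucc V p) ∉ V := by
  intro h
  have hfin : {m : ℕ | ∃ n, m = n + 1 ∧ ANode.node p n ∈ V}.Finite := by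
    have hpre : (ANode.node p ⁻¹' V).Finite :=
      hV.preimage fun a _ b _ hab => (ANode.node.inj hab).2
    refine (hpre.image Nat.succ).subset ?_
    rintro m ⟨n, rfl, hn⟩
    exact ⟨n, hn, rfl⟩
  have hle : maxpSucc V p + 1 ≤ maxpSucc V p := le_csSup hfin.bddAbove ⟨_, rfl, h⟩
  omega

theorem node_mem_of_lt_maxpSucc {R : Type} (A : AnnDAG R) (p : PID) {n : ℕ}
    (hn : n < maxpSucc A.V p) : ANode.node p n ∈ A.V := by
  obtain ⟨m, ⟨k, rfl, hk⟩, hnk⟩ := exists_lt_of_lt_csSup' hn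
  exact A.down p k hk n (by omega)

namespace AnnDAG

/-- The relation of being joined by an `r`-labeled write edge. -/
def WriteRel {R : Type} (A : AnnDAG R) (r : R) (a b : ANode) : Prop := (a, r, b) ∈ A.EW

theorem mem_V_of_reflTransGen {R : Type} (A : AnnDAG R) {r : R} {v : ANode}
    (h : Relation.ReflTransGen (A.WriteRel r) ANode.bot v) : v ∈ A.V := by
  cases h with
  | refl => exact A.bot_mem
  | tail _ h => exact (A.edges_sub _ (Or.inr h)).2

theorem exists_maximal_write {R : Type} (A : AnnDAG R) (r : R) :
    ∃ v, Relation.ReflTransGen (A.WriteRel r) ANode.bot v ∧ ∀ w, (v, r, w) ∉ A.EW := by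
  have hfin : {v | Relation.ReflTransGen (A.WriteRel r) ANode.bot v}.Finite :=
    A.finV.subset fun _ => A.mem_V_of_reflTransGen
  let T : ANode → ANode → Prop := fun a b => Relation.TransGen (A.WriteRel r) b a
  have : IsStrictOrder ANode T :=
    { irrefl := fun a h => A.acyclic a (Relation.TransGen.mono (fun _ _ hab => ⟨r, Or.inr hab⟩) _ _ h)
      trans := fun _ _ _ hab hbc => hbc.trans hab }
  have hwf : Set.WellFoundedOn _ T := hfin.wellFoundedOn
  obtain ⟨⟨v, hv⟩, -, hmin⟩ :=
    hwf.has_min Set.univ ⟨⟨ANode.bot, Relation.ReflTransGen.refl⟩, trivial⟩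
  exact ⟨v, hv, fun w hw => hmin ⟨w, hv.tail hw⟩ trivial (Relation.TransGen.single hw)⟩

theorem existsUnique_maximal_write {R : Type} (A : AnnDAG R) (r : R) :
    ∃! v, Relation.ReflTransGen (A.WriteRel r) ANode.bot v ∧ ∀ w, (v, r, w) ∉ A.EW := by
  have huniq : Relator.RightUnique (A.WriteRel r) :=
    fun _ _ _ hab hac => A.w_out_unique _ _ _ _ hab hac
  have heq : ∀ {a b}, Relation.ReflTransGen (A.WriteRel r) a b → (∀ w, (a, r, w) ∉ A.EW) →
      a = b := fun h hmax => (h.cases_head).resolve_right fun ⟨c, hc, _⟩ => hmax c hc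
  obtain ⟨v, hv, hmax⟩ := A.exists_maximal_write r
  refine ⟨v, ⟨hv, hmax⟩, fun w ⟨hw, hwmax⟩ => ?_⟩
  rcases Relation.ReflTransGen.total_of_right_unique huniq hv hw with h | h
  · exact (heq h hmax).symm
  · exact heq h hwmax

theorem lastN_spec {R : Type} (A : AnnDAG R) (r : R) :
    Relation.ReflTransGen (A.WriteRel r) ANode.bot (lastN A.EW r) ∧
      ∀ w, (lastN A.EW r, r, w) ∉ A.EW := by
  have h := A.existsUnique_maximal_write r
  have hlast : lastN A.EW r = h.exists.choose := dif_pos h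
  rw [hlast]
  exact h.exists.choose_spec

theorem lastN_mem {R : Type} (A : AnnDAG R) (r : R) : lastN A.EW r ∈ A.V :=
  A.mem_V_of_reflTransGen (A.lastN_spec r).1

theorem exists_write_to_lastN {R : Type} (A : AnnDAG R) {r : R} (h : lastN A.EW r ≠ ANode.bot) :
    ∃ w, (w, r, lastN A.EW r) ∈ A.EW := by
  rcases (A.lastN_spec r).1.cases_tail with h' | ⟨w, -, hw⟩
  · exact absurd h' h
  · exact ⟨w, hw⟩

/-- The edges from the last writers of the resources in `S` to the node `v`. -/
def edgesTo {R : Type} (A : AnnDAG R) (S : Set R) (v : ANode) : Set (AEdge R) :=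
  {e | ∃ r ∈ S, e = (lastN A.EW r, r, v)}

theorem mem_edgesTo {R : Type} {A : AnnDAG R} {S : Set R} {v a b : ANode} {r : R} :
    (a, r, b) ∈ A.edgesTo S v ↔ r ∈ S ∧ a = lastN A.EW r ∧ b = v := by
  constructor
  · rintro ⟨s, hs, h⟩
    obtain ⟨rfl, rfl, rfl⟩ : a = lastN A.EW s ∧ r = s ∧ b = v := by simpa using h
    exact ⟨hs, rfl, rfl⟩
  · rintro ⟨hr, rfl, rfl⟩
    exact ⟨r, hr, rfl⟩

/-- An edge of the extended graph is an old edge, or leads from a last writer to the new node. -/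
theorem edge_cases {R : Type} {A : AnnDAG R} {S T : Set R} {v a b : ANode} {r : R}
    (h : (a, r, b) ∈ (A.ER ∪ A.edgesTo S v) ∪ (A.EW ∪ A.edgesTo T v)) :
    (a, r, b) ∈ A.ER ∪ A.EW ∨ a = lastN A.EW r ∧ b = v := by
  rcases h with (h | h) | (h | h)
  · exact Or.inl (Or.inl h)
  · exact Or.inr (mem_edgesTo.1 h).2
  · exact Or.inl (Or.inr h)
  · exact Or.inr (mem_edgesTo.1 h).2

/-- The result of the forward transition with label `(p, Rd, Wt)`. -/
noncomputable def extend {R : Type} (A : AnnDAG R) (p : PID) (Rd Wt : Set R) : AnnDAG R where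
  V := A.V ∪ {ANode.node p (maxpSucc A.V p)}
  ER := A.ER ∪ A.edgesTo (Rd \ Wt) (ANode.node p (maxpSucc A.V p))
  EW := A.EW ∪ A.edgesTo Wt (ANode.node p (maxpSucc A.V p))
  finV := A.finV.union (Set.finite_singleton _)
  bot_mem := Or.inl A.bot_mem
  down := by
    rintro q n (h | h) n' hn'
    · exact Or.inl (A.down q n h n' hn')
    · obtain ⟨rfl, rfl⟩ := ANode.node.inj h
      rcases hn'.lt_or_eq with hlt | rfl
      · exact Or.inl (node_mem_of_lt_maxpSucc A q hlt)
      · exact Or.inr rfl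
  edges_sub := by
    rintro ⟨a, r, b⟩ h
    rcases edge_cases h with h | ⟨rfl, rfl⟩
    · exact ⟨Or.inl (A.edges_sub _ h).1, Or.inl (A.edges_sub _ h).2⟩
    · exact ⟨Or.inl (A.lastN_mem r), Or.inr rfl⟩
  in_unique := by
    intro a b r v ha hb
    have hv := node_maxpSucc_notMem A.finV p
    rcases edge_cases ha with ha | ⟨rfl, rfl⟩ <;> rcases edge_cases hb with hb | ⟨rfl, h⟩
    · exact A.in_unique a b r v ha hb
    · exact absurd (h ▸ (A.edges_sub _ ha).2) hv
    · exact absurd (A.edges_sub _ hb).2 hv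
    · rfl
  disj := by
    have hv := node_maxpSucc_notMem A.finV p
    refine Set.eq_empty_of_forall_notMem ?_
    rintro ⟨a, r, b⟩ ⟨h | h, h' | h'⟩
    · exact Set.eq_empty_iff_forall_notMem.1 A.disj _ ⟨h, h'⟩
    · exact hv ((mem_edgesTo.1 h').2.2 ▸ (A.edges_sub _ (Or.inl h)).2)
    · exact hv ((mem_edgesTo.1 h).2.2 ▸ (A.edges_sub _ (Or.inr h')).2)
    · exact (mem_edgesTo.1 h).1.2 (mem_edgesTo.1 h').1
  acyclic := by
    have hv := node_maxpSucc_notMem A.finV p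
    have key : ∀ {a b}, Relation.TransGen (fun a b => ∃ r, (a, r, b) ∈
        (A.ER ∪ A.edgesTo (Rd \ Wt) (ANode.node p (maxpSucc A.V p))) ∪
          (A.EW ∪ A.edgesTo Wt (ANode.node p (maxpSucc A.V p)))) a b →
        a ∈ A.V ∧ (b ∈ A.V → Relation.TransGen (fun a b => ∃ r, (a, r, b) ∈ A.ER ∪ A.EW) a b) := by
      intro a b hab
      induction hab with
      | single h =>
        obtain ⟨r, h⟩ := h
        rcases edge_cases h with h | ⟨rfl, rfl⟩
        · exact ⟨(A.edges_sub _ h).1, fun _ => .single ⟨r, h⟩⟩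
        · exact ⟨A.lastN_mem r, fun hb => absurd hb hv⟩
      | tail _ h ih =>
        obtain ⟨r, h⟩ := h
        refine ⟨ih.1, fun hc => ?_⟩
        rcases edge_cases h with h | ⟨rfl, rfl⟩
        · exact (ih.2 (A.edges_sub _ h).1).tail ⟨r, h⟩
        · exact absurd hc hv
    exact fun a ha => A.acyclic a ((key ha).2 (key ha).1)
  w_pred := by
    rintro a r b (h | h) ha
    · exact (A.w_pred a r b h ha).imp fun _ => Or.inl
    · obtain ⟨-, rfl, rfl⟩ := mem_edgesTo.1 h
      exact (A.exists_write_to_lastN ha).imp fun _ => Or.inl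
  w_out_unique := by
    rintro a r b c (hb | hb) (hc | hc)
    · exact A.w_out_unique a r b c hb hc
    · obtain ⟨-, rfl, rfl⟩ := mem_edgesTo.1 hc
      exact absurd hb ((A.lastN_spec r).2 b)
    · obtain ⟨-, rfl, rfl⟩ := mem_edgesTo.1 hb
      exact absurd hc ((A.lastN_spec r).2 c)
    · exact (mem_edgesTo.1 hb).2.2.trans (mem_edgesTo.1 hc).2.2.symm

theorem step_extend {R : Type} (A : AnnDAG R) (p : PID) (Rd Wt : Set R) :
    Step A (A.extend p Rd Wt) p Rd Wt :=
  ⟨rfl, rfl, rfl⟩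

end AnnDAG

/-- the forward annotation transition is always enabled: the new node is
fresh and the resulting triple is again an annotation DAG. -/
theorem stmt3 {R : Type} (A : AnnDAG R) (p : PID) (Rd Wt : Set R) :
    ANode.node p (maxpSucc A.V p) ∉ A.V ∧
    ∃ A' : AnnDAG R, Step A A' p Rd Wt := by
  exact ⟨node_maxpSucc_notMem A.finV p, A.extend p Rd Wt, A.step_extend p Rd Wt⟩

end CRIL
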